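/- arXiv:2205.05525 — 8 statements merged into one kernel-verified Lean document; each statement's English description precedes it below -/
import Mathlib

section
/- Let n be a positive integer, let B(0,α) ⊂ ℝⁿ be the open Euclidean ball of radius α > 0 centered at the origin, let D ⊆ B(0,α) be a star-shaped set centered at 0 (i.e. for every x ∈ D the segment from 0 to x lies in D), and let r̃ = (r₁, r₂, …) be a nonincreasing sequence of positive real numbers with α ≥ r₁ and r_∞ := inf_i r_i > 0. Then there exists δ₁ > 0 such that every finite subset F ⊆ D that is δ₁-dense in D (i.e. D ⊆ ⋃_{x∈F} B(x, δ₁)) is, as a metric subspace of ℝⁿ, r̃-crushable. -/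
/-- The passage from `S` to `T` (with `T ⊊ S`, removing `A = S \ T`) is an `r̃`-crushing
with center `b ∈ T`: for every removed point `a` and every index `i`,
`B(a, rᵢ) ∩ S ⊆ B(b, rᵢ) ∩ S`. -/
def IsCrushingWith {X : Type*} [MetricSpace X] (r : ℕ → ℝ) (S T : Set X) (b : X) : Prop :=
  T ⊂ S ∧ b ∈ T ∧
    ∀ a ∈ S \ T, ∀ i : ℕ, Metric.ball a (r i) ∩ S ⊆ Metric.ball b (r i) ∩ S

/-- The passage from `S` to `T` is an `r̃`-crushing (for some center `b`). -/
def IsCrushing {X : Type*} [MetricSpace X] (r : ℕ → ℝ) (S T : Set X) : Prop :=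
  ∃ b, IsCrushingWith r S T b

/-- A subset `F` of a metric space (viewed as a metric subspace) is `r̃`-crushable:
there is a finite chain `F = S₀ ⊋ S₁ ⊋ ⋯ ⊋ S_k` of `r̃`-crushings ending in a set of
diameter less than `r_∞ = ⨅ i, r i`. -/
def SetCrushable {X : Type*} [MetricSpace X] (r : ℕ → ℝ) (F : Set X) : Prop :=
  ∃ (k : ℕ) (S : ℕ → Set X), S 0 = F ∧ (∀ j < k, IsCrushing r (S j) (S (j + 1))) ∧
    EMetric.diam (S k) < ENNReal.ofReal (⨅ i, r i)

/-- Crushability propagates backwards along a crushing. -/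
theorem SetCrushable.of_isCrushing {X : Type*} [MetricSpace X] {r : ℕ → ℝ} {S T : Set X}
    (h : IsCrushing r S T) (hT : SetCrushable r T) : SetCrushable r S := by
  obtain ⟨k, U, h0, hU, hd⟩ := hT
  refine ⟨k + 1, fun j => Nat.casesOn j S U, rfl, fun j hj => ?_, hd⟩
  cases j with
  | zero => simpa [h0] using h
  | succ j => exact hU j (by omega)

/-- If `b` is close to `(1 - ε) • a`, then every point `s` with `‖s‖ ≤ ‖a‖` lying in a ball
around `a` also lies in the ball of the same radius around `b`. -/
theorem dist_lt_of_dist_smul_lt {E : Type*} [NormedAddCommGroup E] [InnerProductSpace ℝ E]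
    {a b s : E} {α ε δ ρ : ℝ} (hε : 0 ≤ ε) (hε1 : ε ≤ 1) (ha : ‖a‖ ≤ α) (hs : ‖s‖ ≤ ‖a‖)
    (hδρ : δ ≤ ρ) (hδ : ε ^ 2 * α ^ 2 + 2 * ρ * δ ≤ ε * ρ ^ 2)
    (hb : dist ((1 - ε) • a) b < δ) (hsa : dist s a < ρ) : dist s b < ρ := by
  have key : dist s ((1 - ε) • a) ^ 2
      = (1 - ε) * dist s a ^ 2 + ε * ‖s‖ ^ 2 - ε * (1 - ε) * ‖a‖ ^ 2 := by
    rw [dist_eq_norm, dist_eq_norm, norm_sub_sq_real, norm_sub_sq_real, norm_smul,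
      inner_smul_right, mul_pow, Real.norm_eq_abs, sq_abs]
    ring
  have h1 : dist s a ^ 2 ≤ ρ ^ 2 := by gcongr
  have h2 : ‖s‖ ^ 2 ≤ ‖a‖ ^ 2 := by gcongr
  have h3 : ‖a‖ ^ 2 ≤ α ^ 2 := by gcongr
  have h4 : dist s ((1 - ε) • a) ^ 2 ≤ (ρ - δ) ^ 2 := by
    have h5 := mul_le_mul_of_nonneg_left h1 (sub_nonneg.2 hε1)
    have h6 := mul_le_mul_of_nonneg_left h2 hε
    have h7 := mul_le_mul_of_nonneg_left h3 (sq_nonneg ε)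
    nlinarith [sq_nonneg δ]
  have h8 : dist s ((1 - ε) • a) ≤ ρ - δ := (sq_le_sq₀ dist_nonneg (sub_nonneg.2 hδρ)).1 h4
  linarith [dist_triangle s ((1 - ε) • a) b]

/-- Lemma 3.5 (Latschev-type lemma): for a star-shaped set `D ⊆ B(0,α)` in `ℝⁿ` and a
nonincreasing sequence `r̃` of positive scales with `α ≥ r₁` and `inf rᵢ > 0`, there is a
`δ₁ > 0` such that every finite `δ₁`-dense subset `F ⊆ D` is `r̃`-crushable. -/
theorem stmt0 (n : ℕ) (hn : 0 < n) (α : ℝ) (hα : 0 < α)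
    (D : Set (EuclideanSpace ℝ (Fin n))) (hD : D ⊆ Metric.ball 0 α)
    (hstar : ∀ x ∈ D, ∀ t : ℝ, t ∈ Set.Icc (0 : ℝ) 1 → t • x ∈ D)
    (r : ℕ → ℝ) (hr : Antitone r) (hrpos : ∀ i, 0 < r i)
    (hr1 : r 0 ≤ α) (hrinf : 0 < ⨅ i, r i) :
    ∃ δ₁ > 0, ∀ F : Set (EuclideanSpace ℝ (Fin n)), F ⊆ D → F.Finite →
      D ⊆ (⋃ x ∈ F, Metric.ball x δ₁) → SetCrushable r F := by
  set R := ⨅ i, r i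
  have hRr (i : ℕ) : R ≤ r i := ciInf_le ⟨0, by rintro _ ⟨j, rfl⟩; exact (hrpos j).le⟩ i
  have hRα : R ≤ α := (hRr 0).trans hr1
  obtain ⟨ε, hε⟩ : ∃ ε, ε = R ^ 2 / (2 * α ^ 2) := ⟨_, rfl⟩
  have hεpos : 0 < ε := by rw [hε]; positivity
  have hεα : ε * α ^ 2 = R ^ 2 / 2 := by rw [hε]; field_simp
  have hε1 : ε ≤ 1 := by
    rw [hε, div_le_one (by positivity)]
    nlinarith
  refine ⟨ε * R / 4, by positivity, fun F hFD hF hdense => ?_⟩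
  suffices h : ∀ (N : ℕ) (S : Set (EuclideanSpace ℝ (Fin n))), S ⊆ F → S.ncard = N →
      (∀ x ∈ F, ∀ y ∈ S, ‖x‖ < ‖y‖ → x ∈ S) → SetCrushable r S from
    h _ F subset_rfl rfl fun x hx _ _ _ => hx
  intro N
  induction N using Nat.strong_induction_on with
  | _ N ih =>
  intro S hSF hN hlow
  have hS : S.Finite := hF.subset hSF
  by_cases hsmall : ∀ x ∈ S, ‖x‖ < R / 4
  · refine ⟨0, fun _ => S, rfl, by simp, ?_⟩
    refine (Metric.ediam_le_of_forall_dist_le (C := R / 2) fun x hx y hy => ?_).trans_lt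
      ((ENNReal.ofReal_lt_ofReal_iff hrinf).2 (by linarith))
    linarith [dist_le_norm_add_norm x y, hsmall x hx, hsmall y hy]
  push Not at hsmall
  obtain ⟨x, hxS, hx⟩ := hsmall
  obtain ⟨a, haS, hamax⟩ := Set.exists_max_image S norm hS ⟨x, hxS⟩
  have haR : R / 4 ≤ ‖a‖ := hx.trans (hamax x hxS)
  have haD : a ∈ D := hFD (hSF haS)
  have haα : ‖a‖ ≤ α := (mem_ball_zero_iff.1 (hD haD)).le
  obtain ⟨b, hbF, hb⟩ := Set.mem_iUnion₂.1
    (hdense (hstar a haD (1 - ε) ⟨by linarith, by linarith⟩))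
  rw [Metric.mem_ball] at hb
  have hba : ‖b‖ < ‖a‖ := by
    have h1 : ‖b‖ ≤ ‖(1 - ε) • a‖ + dist ((1 - ε) • a) b := by
      rw [dist_eq_norm]; simpa [norm_sub_rev] using norm_le_norm_add_norm_sub' b ((1 - ε) • a)
    rw [norm_smul, Real.norm_of_nonneg (by linarith)] at h1
    nlinarith
  refine SetCrushable.of_isCrushing (T := S \ {a}) ⟨b, ?_, ?_, ?_⟩ (ih _ ?_ _ ?_ rfl ?_)
  · exact Set.sdiff_singleton_ssubset.2 haS
  · exact ⟨hlow b hbF a haS hba, by rintro rfl; exact hba.false⟩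
  · rintro c ⟨hcS, hc⟩ i s ⟨hs, hsS⟩
    obtain rfl : c = a := by simpa [hcS] using hc
    have hRi := hRr i
    refine ⟨dist_lt_of_dist_smul_lt hεpos.le hε1 haα (hamax s hsS) ?_ ?_ hb hs, hsS⟩
    · nlinarith
    · have h1 : R ^ 2 ≤ r i ^ 2 := by gcongr
      have h2 : r i * R ≤ r i ^ 2 := by nlinarith
      have h3 : ε ^ 2 * α ^ 2 = ε * (R ^ 2 / 2) := by rw [← hεα]; ring
      nlinarith
  · exact hN ▸ Set.ncard_sdiff_singleton_lt_of_mem haS hS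
  · exact Set.sdiff_subset.trans hSF
  · rintro y hy z ⟨hzS, -⟩ hyz
    exact ⟨hlow y hy z hzS hyz, by rintro rfl; exact (hyz.trans_le (hamax z hzS)).false⟩
end

section
/- Let n be a positive integer, let B(0,α) ⊂ ℝⁿ be the open Euclidean ball of radius α > 0 centered at the origin, let D ⊆ B(0,α) be a star-shaped set centered at 0 containing 0, and let r̃ = (r₁, r₂, …) be a nonincreasing sequence of positive real numbers with α ≥ r₁ and r_∞ := inf_i r_i > 0. Set δ′₁ = (1/7)·r_∞·(1 − √(1 − r_∞²/(4α²))). Then every nonempty metric space (Y,d) for which there exist a metric space Z and isometric embeddings φ : D → Z and ψ : Y → Z with Hausdorff distance d_H(φ(D), ψ(Y)) < δ′₁ is r̃-crushable. -/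
/-- Membership in the reflexive transitive closure of crushing gives an explicit finite chain. -/
lemma exists_chain_of_reflTransGen {X : Type*} [MetricSpace X] {r : ℕ → ℝ} {F T : Set X}
    (h : Relation.ReflTransGen (IsCrushing r) F T) :
    ∃ (k : ℕ) (S : ℕ → Set X), S 0 = F ∧ S k = T ∧
      ∀ j < k, IsCrushing r (S j) (S (j + 1)) := by
  induction h using Relation.ReflTransGen.head_induction_on with
  | refl => exact ⟨0, fun _ => T, rfl, rfl, by simp⟩
  | @head A B hab _ ih =>
    obtain ⟨k, S, h0, hk, hS⟩ := ih
    refine ⟨k + 1, fun j => Nat.casesOn j A S, rfl, hk, ?_⟩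
    rintro (_ | j) hj
    · simpa [h0] using hab
    · exact hS j (by omega)

/-- A set that crushes in finitely many steps to a singleton is crushable. -/
lemma setCrushable_of_reflTransGen_singleton {X : Type*} [MetricSpace X] {r : ℕ → ℝ}
    {F : Set X} {b : X} (hr : 0 < ⨅ i, r i)
    (h : Relation.ReflTransGen (IsCrushing r) F {b}) : SetCrushable r F := by
  obtain ⟨k, S, h0, hk, hS⟩ := exists_chain_of_reflTransGen h
  refine ⟨k, S, h0, hS, ?_⟩
  have hdiam : EMetric.diam ({b} : Set X) = 0 := Metric.ediam_singleton
  rw [hk, hdiam]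
  exact ENNReal.ofReal_pos.2 hr

/-- Removing a possibly empty set of points dominated by `b` is at most one crushing. -/
lemma reflTransGen_isCrushing_of_subset {X : Type*} [MetricSpace X] {r : ℕ → ℝ} {S T : Set X}
    {b : X} (hTS : T ⊆ S) (hb : b ∈ T)
    (h : ∀ a ∈ S \ T, ∀ p ∈ S, ∀ i, dist p a < r i → dist p b < r i) :
    Relation.ReflTransGen (IsCrushing r) S T := by
  rcases hTS.eq_or_ssubset with rfl | hss
  · exact .refl
  · exact .single ⟨b, hss, hb, fun a ha i p hp => ⟨h a ha p hp.2 i hp.1, hp.2⟩⟩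

/-- Contracting `a` towards the origin by the factor `1 - m` brings it close to every `p` in
the ball of radius `α` which is not much longer than `a` and lies within `R` of `a`. -/
lemma dist_contraction_lt {E : Type*} [NormedAddCommGroup E] [InnerProductSpace ℝ E]
    {α ρ m δ R t : ℝ} {p a : E} (hα : 0 < α) (hδ : 0 < δ) (hρα : ρ ≤ α)
    (hm : m * (2 * α ^ 2) = ρ ^ 2) (hm0 : 0 < m) (hm1 : m ≤ 1 / 2)
    (hδm : 14 * δ ≤ m * ρ) (hδρ : ρ ^ 2 * (1 - m / 2) ≤ (ρ - 7 * δ) ^ 2)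
    (hρ : 0 < ρ) (hR : ρ ≤ R) (htα : t ≤ α) (hδt : δ ≤ t)
    (hp : ‖p‖ ≤ t) (ha : t - δ ≤ ‖a‖) (hpa : dist p a < R) :
    dist p ((1 - m) • a) < R - 5 * δ := by
  have hid : ‖p - (1 - m) • a‖ ^ 2
      = m * ‖p‖ ^ 2 + (1 - m) * ‖p - a‖ ^ 2 - m * (1 - m) * ‖a‖ ^ 2 := by
    rw [norm_sub_sq_real, norm_sub_sq_real, norm_smul, inner_smul_right, mul_pow,
      Real.norm_eq_abs, sq_abs]
    ring
  rw [dist_eq_norm] at *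
  have h1 : ‖p‖ ^ 2 ≤ t ^ 2 := by gcongr
  have h2 : ‖p - a‖ ^ 2 < R ^ 2 := by gcongr
  have h3 : (t - δ) ^ 2 ≤ ‖a‖ ^ 2 := by
    have : 0 ≤ t - δ := by linarith
    gcongr
  have h4 : ‖p - (1 - m) • a‖ ^ 2 < m * t ^ 2 + (1 - m) * R ^ 2 - m * (1 - m) * (t - δ) ^ 2 := by
    rw [hid]
    have e1 := mul_le_mul_of_nonneg_left h1 hm0.le
    have e2 := mul_lt_mul_of_pos_left h2 (show 0 < 1 - m by linarith)
    have e3 := mul_le_mul_of_nonneg_left h3 (show 0 ≤ m * (1 - m) by nlinarith)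
    linarith
  have hδρ' : 28 * δ ≤ ρ := by nlinarith
  have hmα : 2 * (m * α) ≤ ρ := by
    have : 2 * (m * α) * α ≤ ρ * α := by nlinarith
    exact le_of_mul_le_mul_right this hα
  have h5 : m * t ^ 2 - m * (1 - m) * (t - δ) ^ 2 ≤ m * ρ ^ 2 / 2 + ρ * δ := by
    have e1 : m ^ 2 * t ^ 2 ≤ m ^ 2 * α ^ 2 := by
      have : 0 ≤ t := by linarith
      gcongr
    have e2 : m ^ 2 * α ^ 2 = m * ρ ^ 2 / 2 := by rw [← hm]; ring
    have e3 : 2 * (m * (1 - m)) * t * δ ≤ ρ * δ := by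
      have : 2 * (m * (1 - m)) * t ≤ ρ := by
        calc 2 * (m * (1 - m)) * t ≤ 2 * (m * 1) * α := by
              have : 0 ≤ t := by linarith
              have : 0 ≤ 1 - m := by linarith
              gcongr
              linarith
          _ ≤ ρ := by linarith
      gcongr
    have e4 : 0 ≤ m * (1 - m) * δ ^ 2 := by
      have : 0 ≤ 1 - m := by linarith
      positivity
    nlinarith
  have h6 : m * ρ ^ 2 / 2 + ρ * δ + (1 - m) * R ^ 2 ≤ (R - 5 * δ) ^ 2 := by
    have e1 : 0 ≤ (R - ρ) * (m * (R + ρ) - 10 * δ) := by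
      apply mul_nonneg
      · linarith
      · nlinarith
    nlinarith
  exact lt_of_pow_lt_pow_left₀ 2 (by linarith) (by linarith)

section Approximation

variable {E Y : Type*} [NormedAddCommGroup E] [InnerProductSpace ℝ E] [MetricSpace Y]
  {r : ℕ → ℝ} {D : Set E} {f : Y → E} {g : E → Y} {α ρ m δ : ℝ}

/-- If `Y` is `δ`-close to a star-shaped set `D` through `f : Y → D` and `g : D → Y`, then an
outer layer of thickness `δ` of `Y` can be crushed away. -/
lemma reflTransGen_isCrushing_layer
    (hstar : ∀ x ∈ D, ∀ t : ℝ, t ∈ Set.Icc (0 : ℝ) 1 → t • x ∈ D) (hDb : TotallyBounded D)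
    (hfD : ∀ y, f y ∈ D) (hff : ∀ y y', dist (f y) (f y') < dist y y' + 2 * δ)
    (hg : ∀ x ∈ D, ∀ y, dist y (g x) < dist (f y) x + 2 * δ)
    (hfg : ∀ x ∈ D, dist (f (g x)) x < 2 * δ)
    (hα : 0 < α) (hδ : 0 < δ) (hρα : ρ ≤ α)
    (hm : m * (2 * α ^ 2) = ρ ^ 2) (hm0 : 0 < m) (hm1 : m ≤ 1 / 2)
    (hδm : 14 * δ ≤ m * ρ) (hδρ : ρ ^ 2 * (1 - m / 2) ≤ (ρ - 7 * δ) ^ 2)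
    (hρ : 0 < ρ) (hρr : ∀ i, ρ ≤ r i) {t : ℝ} (htα : t ≤ α) (htρ : 3 / 4 * ρ ≤ t) :
    Relation.ReflTransGen (IsCrushing r) {y | ‖f y‖ ≤ t} {y | ‖f y‖ ≤ t - δ} := by
  have hδρ' : 28 * δ ≤ ρ := by nlinarith
  let C : E → Set Y := fun c => {y | t - δ < ‖f y‖ ∧ f y ∈ Metric.ball c (δ / 2)}
  have key : ∀ F : Set E, F.Finite → Relation.ReflTransGen (IsCrushing r) {y | ‖f y‖ ≤ t}
      ({y | ‖f y‖ ≤ t} \ ⋃ c ∈ F, C c) := by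
    intro F hF
    induction F, hF using Set.Finite.induction_on with
    | empty => simpa using Relation.ReflTransGen.refl
    | @insert c F _ _ ih =>
      refine ih.trans ?_
      rw [Set.biUnion_insert, Set.union_comm, ← Set.sdiff_sdiff]
      set S := {y | ‖f y‖ ≤ t} \ ⋃ c ∈ F, C c with hS
      rcases (S ∩ C c).eq_empty_or_nonempty with he | ⟨a₀, ha₀S, ha₀C⟩
      · rw [(Set.disjoint_iff_inter_eq_empty.2 he).sdiff_eq_left]
      have hbD : (1 - m) • f a₀ ∈ D := hstar _ (hfD _) _ ⟨by linarith, by linarith⟩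
      have ha₀t : ‖f a₀‖ ≤ t := ha₀S.1
      have hb : ‖f (g ((1 - m) • f a₀))‖ ≤ t - δ := by
        have h1 := hfg _ hbD
        rw [dist_eq_norm] at h1
        have h2 := norm_sub_norm_le (f (g ((1 - m) • f a₀))) ((1 - m) • f a₀)
        rw [norm_smul, Real.norm_of_nonneg (by linarith : 0 ≤ 1 - m)] at h2
        have h3 : 3 * δ ≤ m * ‖f a₀‖ := by
          have h4 := ha₀C.1
          have : m * (ρ / 2) ≤ m * ‖f a₀‖ := by
            gcongr
            linarith
          linarith
        linarith
      refine reflTransGen_isCrushing_of_subset Set.sdiff_subset (b := g ((1 - m) • f a₀)) ?_ ?_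
      · refine ⟨⟨show _ ≤ t by linarith, ?_⟩, fun h => (h.1.trans_le hb).false⟩
        simp only [Set.mem_iUnion, not_exists]
        exact fun c' _ h => (h.1.trans_le hb).false
      · rintro a ⟨haS, haC⟩ p hp i hpa
        have haC : a ∈ C c := by
          by_contra h
          exact haC ⟨haS, h⟩
        have h1 : dist (f a) (f a₀) < δ := by
          have := dist_triangle_right (f a) (f a₀) c
          have e1 := Metric.mem_ball.1 haC.2
          have e2 := Metric.mem_ball.1 ha₀C.2
          linarith
        have h2 : dist (f p) (f a₀) < r i + 3 * δ := by
          have e1 := dist_triangle (f p) (f a) (f a₀)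
          have e2 := hff p a
          linarith
        have h3 := dist_contraction_lt hα hδ hρα hm hm0 hm1 hδm hδρ hρ
          (show ρ ≤ r i + 3 * δ by linarith [hρr i]) htα (by linarith) hp.1 ha₀C.1.le h2
        have h4 := hg _ hbD p
        linarith
  obtain ⟨F, hF, hDF⟩ := Metric.totallyBounded_iff.1 hDb (δ / 2) (by linarith)
  convert key F hF using 1
  ext y
  simp only [Set.mem_sdiff, Set.mem_iUnion, not_exists, Set.mem_ofPred_eq]
  constructor
  · exact fun h => ⟨by linarith, fun c _ hc => (hc.1.trans_le h).false⟩
  · rintro ⟨_, h2⟩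
    by_contra h
    obtain ⟨c, hc, hyc⟩ := Set.mem_iUnion₂.1 (hDF (hfD y))
    exact h2 c hc ⟨not_le.1 h, hyc⟩

/-- A space `δ`-close to a star-shaped set `D` through `f : Y → D` and `g : D → Y` crushes to a
point. -/
lemma reflTransGen_isCrushing_univ_singleton
    (hstar : ∀ x ∈ D, ∀ t : ℝ, t ∈ Set.Icc (0 : ℝ) 1 → t • x ∈ D) (hDb : TotallyBounded D)
    (hD : D ⊆ Metric.ball 0 α) (hD0 : (0 : E) ∈ D)
    (hfD : ∀ y, f y ∈ D) (hff : ∀ y y', dist (f y) (f y') < dist y y' + 2 * δ)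
    (hg : ∀ x ∈ D, ∀ y, dist y (g x) < dist (f y) x + 2 * δ)
    (hfg : ∀ x ∈ D, dist (f (g x)) x < 2 * δ)
    (hα : 0 < α) (hδ : 0 < δ) (hρα : ρ ≤ α)
    (hm : m * (2 * α ^ 2) = ρ ^ 2) (hm0 : 0 < m) (hm1 : m ≤ 1 / 2)
    (hδm : 14 * δ ≤ m * ρ) (hδρ : ρ ^ 2 * (1 - m / 2) ≤ (ρ - 7 * δ) ^ 2)
    (hρ : 0 < ρ) (hρr : ∀ i, ρ ≤ r i) :
    Relation.ReflTransGen (IsCrushing r) Set.univ {g 0} := by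
  have hδρ' : 28 * δ ≤ ρ := by nlinarith
  have hlayers : ∀ k : ℕ, ∃ t ≤ α, t ≤ max (α - k * δ) (3 / 4 * ρ) ∧ ρ / 2 ≤ t ∧
      Relation.ReflTransGen (IsCrushing r) Set.univ {y | ‖f y‖ ≤ t} := by
    intro k
    induction k with
    | zero =>
      refine ⟨α, le_rfl, by simp, by linarith, ?_⟩
      rw [Set.eq_univ_of_forall (s := {y | ‖f y‖ ≤ α})
        fun y => (mem_ball_zero_iff.1 (hD (hfD y))).le]
    | succ k ih =>
      obtain ⟨t, htα, htk, ht0, ht⟩ := ih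
      rcases le_or_gt t (3 / 4 * ρ) with h | h
      · exact ⟨t, htα, le_max_of_le_right h, ht0, ht⟩
      · have h' := (le_max_iff.1 htk).resolve_right (not_le.2 h)
        refine ⟨t - δ, by linarith, le_max_of_le_left ?_, by linarith,
          ht.trans (reflTransGen_isCrushing_layer hstar hDb hfD hff hg hfg hα hδ hρα hm hm0 hm1
            hδm hδρ hρ hρr htα h.le)⟩
        push_cast
        linarith
  obtain ⟨k, hk⟩ := exists_nat_gt (α / δ)
  rw [div_lt_iff₀ hδ] at hk
  obtain ⟨t, -, htk, ht0, ht⟩ := hlayers k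
  have htρ : t ≤ 3 / 4 * ρ := htk.trans (max_le (by linarith) le_rfl)
  refine ht.trans (reflTransGen_isCrushing_of_subset (b := g 0) ?_ rfl ?_)
  · rintro _ rfl
    have := hfg 0 hD0
    rw [dist_zero_right] at this
    exact this.le.trans (by linarith)
  · intro a _ p hp i _
    have := hg 0 hD0 p
    rw [dist_zero_right] at this
    have hp : ‖f p‖ ≤ t := hp
    linarith [hρr i]

end Approximation

/-- Two isometrically embedded spaces at Hausdorff distance less than `δ` are related by maps in
both directions that distort distances by less than `2 * δ`. -/
lemma exists_approximation_of_hausdorffEDist_lt {E Y Z : Type*} [MetricSpace E] [MetricSpace Y]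
    [Nonempty Y] [MetricSpace Z] {D : Set E} {φ : D → Z} {ψ : Y → Z} {δ : NNReal}
    (hφ : Isometry φ) (hψ : Isometry ψ)
    (hH : Metric.hausdorffEDist (Set.range φ) (Set.range ψ) < δ) :
    ∃ (f : Y → E) (g : E → Y), (∀ y, f y ∈ D) ∧
      (∀ y y', dist (f y) (f y') < dist y y' + 2 * δ) ∧
      (∀ x ∈ D, ∀ y, dist y (g x) < dist (f y) x + 2 * δ) ∧
      ∀ x ∈ D, dist (f (g x)) x < 2 * δ := by
  have hf : ∀ y, ∃ (x : E) (hx : x ∈ D), dist (ψ y) (φ ⟨x, hx⟩) < δ := by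
    intro y
    rw [Metric.hausdorffEDist_comm] at hH
    obtain ⟨_, ⟨x, rfl⟩, hx⟩ :=
      Metric.exists_edist_lt_of_hausdorffEDist_lt (Set.mem_range_self y) hH
    rw [edist_nndist, ENNReal.coe_lt_coe] at hx
    exact ⟨x, x.2, by exact_mod_cast hx⟩
  have hg : ∀ x : E, ∃ y, ∀ hx : x ∈ D, dist (φ ⟨x, hx⟩) (ψ y) < δ := by
    intro x
    by_cases hx : x ∈ D
    · obtain ⟨_, ⟨y, rfl⟩, hy⟩ :=
        Metric.exists_edist_lt_of_hausdorffEDist_lt (Set.mem_range_self ⟨x, hx⟩) hH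
      rw [edist_nndist, ENNReal.coe_lt_coe] at hy
      exact ⟨y, fun _ => by exact_mod_cast hy⟩
    · exact ⟨Classical.arbitrary Y, fun h => (hx h).elim⟩
  choose f hfD hf using hf
  choose g hg using hg
  have hdist : ∀ {x x'} (hx : x ∈ D) (hx' : x' ∈ D),
      dist (φ ⟨x, hx⟩) (φ ⟨x', hx'⟩) = dist x x' := fun hx hx' => hφ.dist_eq _ _
  refine ⟨f, g, hfD, fun y y' => ?_, fun x hx y => ?_, fun x hx => ?_⟩
  · have h := dist_triangle4 (φ ⟨f y, hfD y⟩) (ψ y) (ψ y') (φ ⟨f y', hfD y'⟩)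
    rw [hψ.dist_eq, dist_comm _ (ψ y), hdist] at h
    linarith [hf y, hf y']
  · have h := dist_triangle4 (ψ y) (φ ⟨f y, hfD y⟩) (φ ⟨x, hx⟩) (ψ (g x))
    rw [hψ.dist_eq, hdist] at h
    linarith [hf y, hg x hx]
  · have h := dist_triangle_left (φ ⟨f (g x), hfD (g x)⟩) (φ ⟨x, hx⟩) (ψ (g x))
    rw [dist_comm (ψ (g x)) (φ ⟨x, hx⟩), hdist] at h
    linarith [hf (g x), hg x hx]

/-- Every metric space `Y` at Gromov–Hausdorff distance less than
`δ′₁ = (1/7)·r_∞·(1 − √(1 − r_∞²/(4α²)))` from a star-shaped subset `D ⊆ B(0,α)` of `ℝⁿ`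
(the proximity expressed via a common isometric embedding into a metric space `Z`)
is `r̃`-crushable. -/
theorem stmt1 (n : ℕ) (hn : 0 < n) (α : ℝ) (hα : 0 < α)
    (D : Set (EuclideanSpace ℝ (Fin n))) (hD : D ⊆ Metric.ball 0 α)
    (hD0 : (0 : EuclideanSpace ℝ (Fin n)) ∈ D)
    (hstar : ∀ x ∈ D, ∀ t : ℝ, t ∈ Set.Icc (0 : ℝ) 1 → t • x ∈ D)
    (r : ℕ → ℝ) (hr : Antitone r) (hrpos : ∀ i, 0 < r i)
    (hr1 : r 0 ≤ α) (hrinf : 0 < ⨅ i, r i)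
    (Y : Type) [MetricSpace Y] [Nonempty Y]
    (hGH : ∃ (Z : Type) (_ : MetricSpace Z) (φ : D → Z) (ψ : Y → Z),
      Isometry φ ∧ Isometry ψ ∧
        EMetric.hausdorffEdist (Set.range φ) (Set.range ψ) <
          ENNReal.ofReal
            ((1 / 7) * (⨅ i, r i) * (1 - Real.sqrt (1 - (⨅ i, r i) ^ 2 / (4 * α ^ 2))))) :
    SetCrushable r (Set.univ : Set Y) := by
  set ρ := ⨅ i, r i with hρdef
  obtain ⟨Z, _, φ, ψ, hφ, hψ, hH⟩ := hGH
  have hρr : ∀ i, ρ ≤ r i := fun i => ciInf_le ⟨0, by rintro _ ⟨j, rfl⟩; exact (hrpos j).le⟩ i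
  have hρα : ρ ≤ α := (hρr 0).trans hr1
  change Metric.hausdorffEDist _ _ < _ at hH
  obtain ⟨δ, hHδ, hδ⟩ := ENNReal.lt_iff_exists_nnreal_btwn.1 hH
  have hδ0 : 0 < (δ : ℝ) := by
    have : (0 : ENNReal) < δ := (zero_le).trans_lt hHδ
    exact_mod_cast this
  rw [← ENNReal.ofReal_coe_nnreal, ENNReal.ofReal_lt_ofReal_iff'] at hδ
  have hδ := hδ.1
  obtain ⟨f, g, hfD, hff, hg, hfg⟩ := exists_approximation_of_hausdorffEDist_lt hφ hψ hHδ
  have hx0 : 0 ≤ 1 - ρ ^ 2 / (4 * α ^ 2) := by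
    rw [sub_nonneg, div_le_one (by positivity)]
    nlinarith
  have hm : ρ ^ 2 / (2 * α ^ 2) * (2 * α ^ 2) = ρ ^ 2 := div_mul_cancel₀ _ (by positivity)
  have hm0 : 0 < ρ ^ 2 / (2 * α ^ 2) := by positivity
  have hm1 : ρ ^ 2 / (2 * α ^ 2) ≤ 1 / 2 := by
    rw [div_le_iff₀ (by positivity)]
    nlinarith
  have hmx : ρ ^ 2 / (4 * α ^ 2) = ρ ^ 2 / (2 * α ^ 2) / 2 := by
    field_simp
    norm_num
  rw [hmx] at hδ hx0
  set m := ρ ^ 2 / (2 * α ^ 2) with hmdef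
  set s := √(1 - m / 2) with hs
  have hs2 : s ^ 2 = 1 - m / 2 := Real.sq_sqrt hx0
  have hs0 : 0 ≤ s := Real.sqrt_nonneg _
  have hs1 : 1 - m / 2 ≤ s := by
    have : s ≤ 1 := Real.sqrt_le_one.2 (by linarith)
    nlinarith
  have hDb : TotallyBounded D :=
    ((isCompact_closedBall 0 α).totallyBounded).subset (hD.trans Metric.ball_subset_closedBall)
  refine setCrushable_of_reflTransGen_singleton hrinf
    (reflTransGen_isCrushing_univ_singleton hstar hDb hD hD0 hfD hff hg hfg hα hδ0 hρα hm hm0 hm1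
      ?_ ?_ hrinf hρr)
  · nlinarith
  · rw [← hs2, ← mul_pow]
    have : 0 ≤ ρ * s := by positivity
    exact pow_le_pow_left₀ this (by linarith) 2
end

section
/- Let (X,d) be a metric space and A ⊆ X a finite subset. Then there exists a finite set R_A ⊂ (0,∞) such that for every α ∈ (0,∞)∖R_A there exists μ > 0 with the following property: for every nonempty subset σ ⊆ A, the intersection ⋂_{x∈σ} B(x,α) is empty if and only if the intersection ⋂_{x∈σ} B(x, α+μ) is empty, where B(x,r) denotes the open metric ball in X of radius r centered at x. -/
open Filter Topology

/-- Away from its infimum, membership in an upper set of reals is stable under small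
increases. -/
lemma IsUpperSet.eventually_mem_iff_add_mem {S : Set ℝ} (hS : IsUpperSet S) {α : ℝ}
    (hα : α ≠ sInf S) : ∀ᶠ μ in 𝓝[>] (0 : ℝ), (α ∈ S ↔ α + μ ∈ S) := by
  by_cases hmem : α ∈ S
  · filter_upwards [self_mem_nhdsWithin] with μ hμ
    exact iff_of_true hmem (hS (le_add_of_nonneg_right (le_of_lt hμ)) hmem)
  have hlb : α ∈ lowerBounds S := fun s hs =>
    le_of_not_ge fun h => hmem (hS h hs)
  rcases S.eq_empty_or_nonempty with rfl | hne
  · simp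
  have hlt : α < sInf S := lt_of_le_of_ne (le_csInf hne hlb) hα
  filter_upwards [mem_nhdsWithin_of_mem_nhds (Iio_mem_nhds (sub_pos.2 hlt))] with μ hμ
  exact iff_of_false hmem (notMem_of_lt_csInf (lt_sub_iff_add_lt'.1 hμ) ⟨α, hlb⟩)

lemma isUpperSet_nonempty_iInter_ball {X : Type*} [PseudoMetricSpace X] (σ : Set X) :
    IsUpperSet {r : ℝ | (⋂ x ∈ σ, Metric.ball x r).Nonempty} := fun _ _ hrs hr =>
  hr.mono (Set.iInter₂_mono fun _ _ => Metric.ball_subset_ball hrs)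


/-- For every finite subset `A` of a metric space `X` there is a finite exceptional set
`R_A ⊂ (0,∞)` such that for every `α ∈ (0,∞) ∖ R_A` there is `μ > 0` with: for each
nonempty `σ ⊆ A`, `⋂_{x∈σ} B(x,α) = ∅` iff `⋂_{x∈σ} B(x,α+μ) = ∅`. -/
theorem stmt2 {X : Type*} [MetricSpace X] (A : Set X) (hA : A.Finite) :
    ∃ R : Set ℝ, R.Finite ∧ R ⊆ Set.Ioi (0 : ℝ) ∧
      ∀ α ∈ Set.Ioi (0 : ℝ) \ R, ∃ μ > 0,
        ∀ σ ⊆ A, σ.Nonempty →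
          ((⋂ x ∈ σ, Metric.ball x α) = ∅ ↔ (⋂ x ∈ σ, Metric.ball x (α + μ)) = ∅) := by
  let S : Set X → Set ℝ := fun σ => {r | (⋂ x ∈ σ, Metric.ball x r).Nonempty}
  refine ⟨(fun σ => sInf (S σ)) '' 𝒫 A ∩ Set.Ioi 0,
    (hA.finite_subsets.image _).inter_of_left _, Set.inter_subset_right, ?_⟩
  rintro α ⟨hα, hαR⟩
  have hev : ∀ᶠ μ in 𝓝[>] (0 : ℝ), ∀ σ ∈ 𝒫 A, (α ∈ S σ ↔ α + μ ∈ S σ) :=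
    (eventually_all_finite hA.finite_subsets).2 fun σ hσ =>
      (isUpperSet_nonempty_iInter_ball σ).eventually_mem_iff_add_mem
        fun h => hαR ⟨⟨σ, hσ, h.symm⟩, hα⟩
  obtain ⟨μ, hμ, hμpos⟩ := (hev.and self_mem_nhdsWithin).exists
  refine ⟨μ, hμpos, fun σ hσ _ => ?_⟩
  exact Set.not_nonempty_iff_eq_empty.symm.trans
    ((not_congr (hμ σ hσ)).trans Set.not_nonempty_iff_eq_empty)
end

section
/- Let Z be a metric space, X ⊆ Z a nonempty compact subset, s > 0, A ⊆ X a finite subset that is s-dense in X (i.e. X ⊆ ⋃_{a∈A} B(a,s)), and δ₂ > 0. Then for every α′ > s there exists ℓ ∈ (0, α′−s) such that for every α ∈ (α′−ℓ, α′) there exists δ′₂ > 0 with the following property: for every nonempty subset Y ⊆ Z with X contained in the open δ′₂-thickening of Y and Y contained in the open δ′₂-thickening of X, and for every nonempty σ ⊆ A, the sets H = X ∩ ⋂_{z∈σ} B(z,α) and H′ = Y ∩ ⋂_{z∈σ} B(z,α) are either both empty, or both nonempty and satisfy d_H(H, H′) < δ₂, where d_H denotes Hausdorff distance in Z. -/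
open Filter Topology in
/-- Points of a compact set lying in an intersection of open balls of radius `r` centred at a subset
of a finite set are uniformly approximated by points in the balls of a slightly smaller radius. -/
theorem IsCompact.exists_pos_dist_lt_inter_ball_sub {Z : Type*} [PseudoMetricSpace Z] {X A : Set Z}
    (hX : IsCompact X) (hA : A.Finite) (r : ℝ) {ε : ℝ} (hε : 0 < ε) :
    ∃ l > 0, ∀ σ ⊆ A, ∀ x ∈ X ∩ ⋂ z ∈ σ, Metric.ball z r,
      ∃ p ∈ X ∩ ⋂ z ∈ σ, Metric.ball z (r - l), dist x p < ε := by
  suffices h : ∀ᶠ l in 𝓝[>] (0 : ℝ), ∀ σ ∈ {σ | σ ⊆ A}, ∀ x ∈ X ∩ ⋂ z ∈ σ, Metric.ball z r,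
      ∃ p ∈ X ∩ ⋂ z ∈ σ, Metric.ball z (r - l), dist x p < ε by
    obtain ⟨l, hl, hpos⟩ := (h.and self_mem_nhdsWithin).exists
    exact ⟨l, hpos, hl⟩
  refine (Filter.eventually_all_finite hA.finite_subsets).2 fun σ hσ => ?_
  have htb : TotallyBounded (X ∩ ⋂ z ∈ σ, Metric.ball z r) :=
    hX.totallyBounded.subset Set.inter_subset_left
  obtain ⟨t, hts, htf, hcov⟩ := htb.exists_subset (Metric.dist_mem_uniformity hε)
  have key : ∀ᶠ l in 𝓝[>] (0 : ℝ), ∀ p ∈ t, ∀ z ∈ σ, dist p z < r - l := by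
    refine (Filter.eventually_all_finite htf).2 fun p hp =>
      (Filter.eventually_all_finite (hA.subset hσ)).2 fun z hz => ?_
    have hpz : dist p z < r := by simpa using Set.mem_iInter₂.1 (hts hp).2 z hz
    filter_upwards [nhdsWithin_le_nhds (eventually_lt_nhds (sub_pos.2 hpz))] with l hl
    linarith
  filter_upwards [key] with l hl x hx
  obtain ⟨p, hp, hxp⟩ := Set.mem_iUnion₂.1 (hcov hx)
  exact ⟨p, ⟨(hts hp).1, Set.mem_iInter₂.2 fun z hz => hl p hp z hz⟩, hxp⟩


/-- Stability of intersections of balls around a dense finite set `A ⊆ X`: for a compact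
nonempty `X ⊆ Z`, an `s`-dense finite `A ⊆ X`, and `δ₂ > 0`, for every `α′ > s` there is a
leverage `ℓ ∈ (0, α′ − s)` such that for every `α ∈ (α′ − ℓ, α′)` there is `δ′₂ > 0` with:
whenever `Y ⊆ Z` is nonempty, `X` lies in the open `δ′₂`-thickening of `Y` and vice versa,
then for each nonempty `σ ⊆ A` the sets `X ∩ ⋂_{z∈σ} B(z,α)` and `Y ∩ ⋂_{z∈σ} B(z,α)`
are both empty, or both nonempty with Hausdorff distance less than `δ₂`. -/
theorem stmt3 {Z : Type*} [MetricSpace Z] (X : Set Z) (hXne : X.Nonempty)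
    (hXc : IsCompact X) (s : ℝ) (hs : 0 < s) (A : Set Z) (hAX : A ⊆ X) (hAfin : A.Finite)
    (hAdense : X ⊆ ⋃ a ∈ A, Metric.ball a s) (δ₂ : ℝ) (hδ₂ : 0 < δ₂) :
    ∀ α' > s, ∃ ℓ ∈ Set.Ioo 0 (α' - s), ∀ α ∈ Set.Ioo (α' - ℓ) α', ∃ δ'₂ > 0,
      ∀ Y : Set Z, Y.Nonempty →
        (∀ x ∈ X, ∃ y ∈ Y, dist x y < δ'₂) →
        (∀ y ∈ Y, ∃ x ∈ X, dist y x < δ'₂) →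
        ∀ σ ⊆ A, σ.Nonempty →
          ((X ∩ ⋂ z ∈ σ, Metric.ball z α) = ∅ ∧ (Y ∩ ⋂ z ∈ σ, Metric.ball z α) = ∅) ∨
          ((X ∩ ⋂ z ∈ σ, Metric.ball z α).Nonempty ∧
            (Y ∩ ⋂ z ∈ σ, Metric.ball z α).Nonempty ∧
            Metric.hausdorffDist (X ∩ ⋂ z ∈ σ, Metric.ball z α)
              (Y ∩ ⋂ z ∈ σ, Metric.ball z α) < δ₂) := by
  intro α' hα'
  have hε : 0 < δ₂ / 4 := by positivity
  obtain ⟨l, hl, happrox⟩ := hXc.exists_pos_dist_lt_inter_ball_sub hAfin α' hε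
  refine ⟨min l ((α' - s) / 2), ⟨lt_min hl (by linarith),
    (min_le_right _ _).trans_lt (by linarith)⟩, ?_⟩
  rintro α ⟨hα₁, hα₂⟩
  have hlα : α' - l ≤ α := by linarith [min_le_left l ((α' - s) / 2)]
  obtain ⟨η, hη, happrox'⟩ := hXc.exists_pos_dist_lt_inter_ball_sub hAfin α hε
  refine ⟨min (min (α' - α) η) (δ₂ / 4), lt_min (lt_min (by linarith) hη) hε, ?_⟩
  intro Y _ hXY hYX σ hσ _
  have hXtoY : ∀ x ∈ X ∩ ⋂ z ∈ σ, Metric.ball z α,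
      ∃ y ∈ Y ∩ ⋂ z ∈ σ, Metric.ball z α, dist x y ≤ δ₂ / 2 := by
    intro x hx
    obtain ⟨p, ⟨hpX, hpσ⟩, hxp⟩ := happrox' σ hσ x hx
    obtain ⟨y, hyY, hpy⟩ := hXY p hpX
    simp only [lt_min_iff] at hpy
    refine ⟨y, ⟨hyY, Set.mem_iInter₂.2 fun z hz => ?_⟩, ?_⟩
    · have hpz : dist p z < α - η := Set.mem_iInter₂.1 hpσ z hz
      rw [Metric.mem_ball]
      linarith [dist_triangle_left y z p]
    · linarith [dist_triangle x p y]
  have hYtoX : ∀ y ∈ Y ∩ ⋂ z ∈ σ, Metric.ball z α,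
      ∃ x ∈ X ∩ ⋂ z ∈ σ, Metric.ball z α, dist y x ≤ δ₂ / 2 := by
    rintro y ⟨hyY, hyσ⟩
    obtain ⟨x, hxX, hyx⟩ := hYX y hyY
    simp only [lt_min_iff] at hyx
    have hxσ : x ∈ ⋂ z ∈ σ, Metric.ball z α' := Set.mem_iInter₂.2 fun z hz => by
      have hyz : dist y z < α := Set.mem_iInter₂.1 hyσ z hz
      rw [Metric.mem_ball]
      linarith [dist_triangle_left x z y]
    obtain ⟨p, ⟨hpX, hpσ⟩, hxp⟩ := happrox σ hσ x ⟨hxX, hxσ⟩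
    refine ⟨p, ⟨hpX, Set.mem_iInter₂.2 fun z hz => ?_⟩, ?_⟩
    · exact Metric.ball_subset_ball hlα (Set.mem_iInter₂.1 hpσ z hz)
    · linarith [dist_triangle y x p]
  rcases (X ∩ ⋂ z ∈ σ, Metric.ball z α).eq_empty_or_nonempty with hH | hH
  · refine Or.inl ⟨hH, Set.eq_empty_of_forall_notMem fun y hy => ?_⟩
    obtain ⟨x, hx, _⟩ := hYtoX y hy
    exact Set.notMem_empty x (hH ▸ hx)
  · obtain ⟨x, hx⟩ := hH
    obtain ⟨y, hy, _⟩ := hXtoY x hx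
    exact Or.inr ⟨⟨x, hx⟩, ⟨y, hy⟩, (Metric.hausdorffDist_le_of_mem_dist (by positivity)
      hXtoY hYtoX).trans_lt (by linarith)⟩
end

section
/- Let (X,d) be a metric space, r̃ = (r₁, r₂, …) a nonincreasing sequence of positive real numbers, and a, b ∈ X points such that B(a, r_i) ⊆ B(b, r_i) for every positive integer i. If σ ⊆ X is a finite r̃-admissible set with a ∈ σ, then both σ ∪ {b} and (σ∖{a}) ∪ {b} are r̃-admissible. -/
/-- A finite subset `σ` of a metric space is `r̃`-admissible (a simplex of the selective
Rips complex `sRips(X; r̃)`) if for every positive integer `i` (index `i : ℕ`, with `r i`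
standing for `r_{i+1}`), `σ` can be written as a union of `i + 1` sets, each of diameter
less than `r i`. -/
def Admissible {X : Type*} [MetricSpace X] (r : ℕ → ℝ) (σ : Set X) : Prop :=
  σ.Finite ∧ ∀ i : ℕ, ∃ P : Fin (i + 1) → Set X,
    σ = (⋃ j, P j) ∧ ∀ j, Metric.diam (P j) < r i

theorem Set.Finite.diam_lt {X : Type*} [MetricSpace X] {s : Set X} (hs : s.Finite) {R : ℝ}
    (hR : 0 < R) (h : ∀ x ∈ s, ∀ y ∈ s, dist x y < R) : Metric.diam s < R := by
  rcases s.eq_empty_or_nonempty with rfl | hne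
  · simpa using hR
  obtain ⟨p, hp, hmax⟩ := (hs.prod hs).exists_maximalFor (fun p : X × X => dist p.1 p.2) _
    (hne.prod hne)
  refine lt_of_le_of_lt (Metric.diam_le_of_forall_dist_le dist_nonneg fun x hx y hy => ?_)
    (h p.1 hp.1 p.2 hp.2)
  exact (le_total (dist x y) (dist p.1 p.2)).elim id
    fun hle => hmax (j := (x, y)) ⟨hx, hy⟩ hle

theorem Admissible.mono {X : Type*} [MetricSpace X] {r : ℕ → ℝ} {σ τ : Set X}
    (hσ : Admissible r σ) (hτ : τ ⊆ σ) : Admissible r τ := by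
  refine ⟨hσ.1.subset hτ, fun i => ?_⟩
  obtain ⟨P, hP, hd⟩ := hσ.2 i
  refine ⟨fun j => τ ∩ P j, ?_, fun j => lt_of_le_of_lt ?_ (hd j)⟩
  · rw [← Set.inter_iUnion, ← hP, Set.inter_eq_left.2 hτ]
  · exact Metric.diam_mono Set.inter_subset_right
      (hσ.1.subset (hP ▸ Set.subset_iUnion P j)).isBounded

theorem Admissible.union_singleton {X : Type*} [MetricSpace X] {r : ℕ → ℝ}
    (hrpos : ∀ i, 0 < r i) {a b : X}
    (hab : ∀ i : ℕ, Metric.ball a (r i) ⊆ Metric.ball b (r i))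
    {σ : Set X} (hσ : Admissible r σ) (ha : a ∈ σ) : Admissible r (σ ∪ {b}) := by
  refine ⟨hσ.1.union (Set.finite_singleton b), fun i => ?_⟩
  obtain ⟨P, hP, hd⟩ := hσ.2 i
  have hfin : ∀ j, (P j).Finite := fun j => hσ.1.subset (hP ▸ Set.subset_iUnion P j)
  have hdist : ∀ j, ∀ x ∈ P j, ∀ y ∈ P j, dist x y < r i := fun j x hx y hy =>
    (Metric.dist_le_diam_of_mem (hfin j).isBounded hx hy).trans_lt (hd j)
  have hb : ∀ j, a ∈ P j → ∀ x ∈ P j, dist x b < r i := fun j haj x hx =>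
    hab i (hdist j x hx a haj)
  obtain ⟨k, hk⟩ := Set.mem_iUnion.1 (hP ▸ ha)
  refine ⟨fun j => P j ∪ {x | x = b ∧ a ∈ P j}, ?_, fun j => Set.Finite.diam_lt ?_ (hrpos i) ?_⟩
  · ext x
    simp only [hP, Set.mem_union, Set.mem_iUnion, Set.mem_singleton_iff, Set.mem_ofPred_eq]
    constructor
    · rintro (⟨j, hj⟩ | rfl)
      · exact ⟨j, .inl hj⟩
      · exact ⟨k, .inr ⟨rfl, hk⟩⟩
    · rintro ⟨j, hj | ⟨rfl, -⟩⟩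
      · exact .inl ⟨j, hj⟩
      · exact .inr rfl
  · exact (hfin j).union ((Set.finite_singleton b).subset fun x hx => hx.1)
  · rintro x (hx | ⟨rfl, haj⟩) y (hy | ⟨rfl, haj'⟩)
    · exact hdist j x hx y hy
    · exact hb j haj' x hx
    · exact dist_comm y x ▸ hb j haj y hy
    · simpa using hrpos i

/-- If `B(a, rᵢ) ⊆ B(b, rᵢ)` for all `i` and `σ` is an `r̃`-admissible finite set
containing `a`, then `σ ∪ {b}` and `(σ ∖ {a}) ∪ {b}` are `r̃`-admissible. -/
theorem stmt4 {X : Type*} [MetricSpace X] (r : ℕ → ℝ) (hr : Antitone r)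
    (hrpos : ∀ i, 0 < r i) (a b : X)
    (hab : ∀ i : ℕ, Metric.ball a (r i) ⊆ Metric.ball b (r i))
    (σ : Set X) (hσ : Admissible r σ) (ha : a ∈ σ) :
    Admissible r (σ ∪ {b}) ∧ Admissible r ((σ \ {a}) ∪ {b}) := by
  have h := hσ.union_singleton hrpos hab ha
  exact ⟨h, h.mono (Set.union_subset_union_left _ Set.sdiff_subset)⟩
end

section
/- Let n be a positive integer, R > 0, and y ∈ ℝⁿ with ‖y‖ ≤ R. For real numbers 0 < s ≤ t, if a point z ∈ ℝⁿ satisfies z ∈ B(x, s) for every x ∈ closedBall(y, s) ∩ closedBall(0, R), then z ∈ B(x, t) for every x ∈ closedBall(y, t) ∩ closedBall(0, R). Equivalently, ⋂_{x ∈ closedBall(y,s) ∩ closedBall(0,R)} B(x,s) ⊆ ⋂_{x ∈ closedBall(y,t) ∩ closedBall(0,R)} B(x,t). -/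
/-- Nesting of the sets `I_{y,i}`: for `0 < s ≤ t ≤ ...` and `‖y‖ ≤ R`,
`⋂_{x ∈ closedBall(y,s) ∩ closedBall(0,R)} B(x,s) ⊆
 ⋂_{x ∈ closedBall(y,t) ∩ closedBall(0,R)} B(x,t)`. -/
theorem stmt5 (n : ℕ) (hn : 0 < n) (R : ℝ) (hR : 0 < R)
    (y : EuclideanSpace ℝ (Fin n)) (hy : ‖y‖ ≤ R)
    (s t : ℝ) (hs : 0 < s) (hst : s ≤ t) :
    (⋂ x ∈ Metric.closedBall y s ∩ Metric.closedBall 0 R, Metric.ball x s) ⊆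
      ⋂ x ∈ Metric.closedBall y t ∩ Metric.closedBall 0 R, Metric.ball x t := by
  intro z hz
  simp only [Set.mem_iInter] at hz ⊢
  rintro x ⟨hxy, hxR⟩
  have ht : 0 < t := hs.trans_le hst
  have hc0 : 0 ≤ s / t := by positivity
  have hc1 : s / t ≤ 1 := (div_le_one ht).2 hst
  have hct : s / t * t = s := div_mul_cancel₀ s ht.ne'
  rw [Metric.mem_closedBall] at hxy
  have hw : AffineMap.lineMap y x (s / t) ∈ Metric.closedBall y s ∩ Metric.closedBall 0 R := by
    constructor
    · rw [Metric.mem_closedBall, dist_lineMap_left, Real.norm_of_nonneg hc0, dist_comm y x]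
      exact (mul_le_mul_of_nonneg_left hxy hc0).trans_eq hct
    · exact (convex_closedBall 0 R).lineMap_mem (by simpa using hy) hxR ⟨hc0, hc1⟩
  have hzw := Metric.mem_ball.1 (hz _ hw)
  have hwx : dist (AffineMap.lineMap y x (s / t)) x ≤ t - s := by
    rw [dist_lineMap_right, Real.norm_of_nonneg (sub_nonneg.2 hc1), dist_comm y x]
    refine (mul_le_mul_of_nonneg_left hxy (sub_nonneg.2 hc1)).trans_eq ?_
    rw [sub_mul, one_mul, hct]
  rw [Metric.mem_ball]
  linarith [dist_triangle z (AffineMap.lineMap y x (s / t)) x]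
end

section
/- Let n be a positive integer, let y ∈ ℝⁿ with ‖y‖ = r′ > 0, and let r be a real number with 0 < r ≤ √2·r′. Define ŷ = (1 − r²/(2r′²))·y and δ₁ = r·(1 − √(1 − r²/(4r′²))). Then for every x ∈ ℝⁿ with ‖x‖ ≤ r′ and ‖x − y‖ ≤ r one has ‖x − ŷ‖ ≤ r − δ₁; in particular the open ball B(ŷ, δ₁) is contained in ⋂_{x ∈ closedBall(y,r) ∩ closedBall(0,r′)} B(x, r). -/
/-- Stewart's identity for a point `(1 - t) • y` of the segment from `0` to `y`. -/
lemma norm_sub_one_sub_smul_sq {E : Type*} [NormedAddCommGroup E] [InnerProductSpace ℝ E]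
    (x y : E) (t : ℝ) :
    ‖x - (1 - t) • y‖ ^ 2 = t * ‖x‖ ^ 2 + (1 - t) * ‖x - y‖ ^ 2 - t * (1 - t) * ‖y‖ ^ 2 := by
  rw [norm_sub_sq_real, norm_sub_sq_real, inner_smul_right, norm_smul, mul_pow,
    Real.norm_eq_abs, sq_abs]
  ring

lemma norm_sub_smul_le_mul_sqrt {E : Type*} [NormedAddCommGroup E] [InnerProductSpace ℝ E]
    {x y : E} {r : ℝ} (hy : 0 < ‖y‖) (hr0 : 0 ≤ r) (hr : r ≤ √2 * ‖y‖)
    (hx : ‖x‖ ≤ ‖y‖) (hxy : ‖x - y‖ ≤ r) :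
    ‖x - (1 - r ^ 2 / (2 * ‖y‖ ^ 2)) • y‖ ≤ r * √(1 - r ^ 2 / (4 * ‖y‖ ^ 2)) := by
  have hr2 : r ^ 2 ≤ 2 * ‖y‖ ^ 2 := by
    calc r ^ 2 ≤ (√2 * ‖y‖) ^ 2 := by gcongr
      _ = 2 * ‖y‖ ^ 2 := by rw [mul_pow, Real.sq_sqrt zero_le_two]
  obtain ⟨t, ht⟩ : ∃ t, t = r ^ 2 / (2 * ‖y‖ ^ 2) := ⟨_, rfl⟩
  have ht0 : 0 ≤ t := by rw [ht]; positivity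
  have ht1 : t ≤ 1 := by rw [ht]; exact div_le_one_of_le₀ hr2 (by positivity)
  have hty : t * ‖y‖ ^ 2 = r ^ 2 / 2 := by rw [ht]; field_simp
  have ht2 : r ^ 2 / (4 * ‖y‖ ^ 2) = t / 2 := by rw [ht]; field_simp; norm_num
  rw [← ht, ht2]
  refine le_of_pow_le_pow_left₀ two_ne_zero (by positivity) ?_
  rw [norm_sub_one_sub_smul_sq, mul_pow, Real.sq_sqrt (by linarith)]
  calc t * ‖x‖ ^ 2 + (1 - t) * ‖x - y‖ ^ 2 - t * (1 - t) * ‖y‖ ^ 2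
      ≤ t * ‖y‖ ^ 2 + (1 - t) * r ^ 2 - t * (1 - t) * ‖y‖ ^ 2 := by
        have : 0 ≤ 1 - t := by linarith
        gcongr
    _ = r ^ 2 * (1 - t / 2) := by linear_combination t * hty

/-- The inscribed ball: for `‖y‖ = r′ > 0` and `0 < r ≤ √2·r′`, with
`ŷ = (1 − r²/(2r′²))·y` and `δ₁ = r·(1 − √(1 − r²/(4r′²)))`, every `x` with `‖x‖ ≤ r′`
and `‖x − y‖ ≤ r` satisfies `‖x − ŷ‖ ≤ r − δ₁`; in particular
`B(ŷ, δ₁) ⊆ ⋂_{x ∈ closedBall(y,r) ∩ closedBall(0,r′)} B(x, r)`. -/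
theorem stmt7 (n : ℕ) (hn : 0 < n) (y : EuclideanSpace ℝ (Fin n)) (r' r : ℝ)
    (hr' : 0 < r') (hy : ‖y‖ = r') (hrpos : 0 < r) (hr : r ≤ Real.sqrt 2 * r') :
    (∀ x : EuclideanSpace ℝ (Fin n), ‖x‖ ≤ r' → ‖x - y‖ ≤ r →
      ‖x - (1 - r ^ 2 / (2 * r' ^ 2)) • y‖ ≤
        r - r * (1 - Real.sqrt (1 - r ^ 2 / (4 * r' ^ 2)))) ∧
    Metric.ball ((1 - r ^ 2 / (2 * r' ^ 2)) • y)
        (r * (1 - Real.sqrt (1 - r ^ 2 / (4 * r' ^ 2)))) ⊆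
      ⋂ x ∈ Metric.closedBall y r ∩ Metric.closedBall 0 r', Metric.ball x r := by
  have key : ∀ x : EuclideanSpace ℝ (Fin n), ‖x‖ ≤ r' → ‖x - y‖ ≤ r →
      ‖x - (1 - r ^ 2 / (2 * r' ^ 2)) • y‖ ≤
        r - r * (1 - Real.sqrt (1 - r ^ 2 / (4 * r' ^ 2))) := by
    subst hy
    intro x hx hxy
    linarith [norm_sub_smul_le_mul_sqrt hr' hrpos.le hr hx hxy]
  refine ⟨key, fun z hz => Set.mem_iInter₂.2 fun x hx => ?_⟩
  have hxy := key x (mem_closedBall_zero_iff.1 hx.2) (mem_closedBall_iff_norm.1 hx.1)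
  rw [← dist_eq_norm] at hxy
  rw [Metric.mem_ball] at hz ⊢
  linarith [dist_triangle_right z x ((1 - r ^ 2 / (2 * r' ^ 2)) • y)]
end

section
/- Let Z be a metric space, let X, Y ⊆ Z, let A ⊆ X, and let α > 0 and μ > 0. Suppose that every point of Y lies at distance less than μ/2 from some point of X, and suppose that for every nonempty σ ⊆ A: if X ∩ ⋂_{x∈σ} B(x, α) is empty then X ∩ ⋂_{x∈σ} B(x, α+μ) is empty. Then for every nonempty σ ⊆ A: if Y ∩ ⋂_{x∈σ} B(x, α) is nonempty, then X ∩ ⋂_{x∈σ} B(x, α) is nonempty. -/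
/-- Surjectivity step: if every point of `Y` is within `μ/2` of `X` and intersections of
`α`-balls and `(α+μ)`-balls around points of `A` within `X` are simultaneously empty, then
nonemptiness of `Y ∩ ⋂_{x∈σ} B(x,α)` forces nonemptiness of `X ∩ ⋂_{x∈σ} B(x,α)`. -/
theorem stmt10 {Z : Type*} [MetricSpace Z] (X Y A : Set Z) (hAX : A ⊆ X)
    (α μ : ℝ) (hα : 0 < α) (hμ : 0 < μ)
    (hYX : ∀ y ∈ Y, ∃ x ∈ X, dist y x < μ / 2)
    (hstab : ∀ σ ⊆ A, σ.Nonempty →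
      (X ∩ ⋂ x ∈ σ, Metric.ball x α) = ∅ →
      (X ∩ ⋂ x ∈ σ, Metric.ball x (α + μ)) = ∅) :
    ∀ σ ⊆ A, σ.Nonempty →
      (Y ∩ ⋂ x ∈ σ, Metric.ball x α).Nonempty →
      (X ∩ ⋂ x ∈ σ, Metric.ball x α).Nonempty := by
  rintro σ hσA hσ ⟨y, hyY, hy⟩
  obtain ⟨p, hpX, hyp⟩ := hYX y hyY
  by_contra hempty
  have hp : p ∈ X ∩ ⋂ x ∈ σ, Metric.ball x (α + μ) := by
    refine ⟨hpX, Set.mem_iInter₂.2 fun x hx => Metric.mem_ball.2 ?_⟩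
    have hyx : dist y x < α := Set.mem_iInter₂.1 hy x hx
    linarith [dist_triangle_left p x y]
  rw [hstab σ hσA hσ (Set.not_nonempty_iff_eq_empty.1 hempty)] at hp
  exact hp
end
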